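/- arXiv:1511.04129 — 3 statements merged into one kernel-verified Lean document; each statement's English description precedes it below -/
import Mathlib

section
/- If G is a finite group, N is a normal subgroup, χ is a complex irreducible character of G, and the restriction of χ to N decomposes as θ₁ + θ₂ + ⋯ + θ_k with each θᵢ irreducible in N, then k divides the index |G : N|. -/
open CategoryTheory Module

/-- The restriction of a finite-dimensional complex representation of `G` to a subgroup `N`. -/
noncomputable def FDRep.res {G : Type} [Group G] (N : Subgroup G) (V : FDRep ℂ G) :
    FDRep ℂ N :=
  FDRep.of (V.ρ.comp N.subtype)

open scoped Pointwise in
/-- If a finite family of units `u i` of `End ℂ U`, closed under products and inverses up to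
scalars, satisfies the Schur orthogonality relations with constant `c`, then `c` is an algebraic
integer. -/
theorem isIntegral_of_sum_units_conj {U ι : Type*} [AddCommGroup U] [Module ℂ U]
    [FiniteDimensional ℂ U] [Nontrivial U] [Fintype ι] (u : ι → (End ℂ U)ˣ) (c : ℂ)
    (hmul : ∀ i j, ∃ k, ∃ a : ℂ, (u i * u j : End ℂ U) = a • (u k : End ℂ U))
    (hinv : ∀ i, ∃ k, ∃ a : ℂ, (↑(u i)⁻¹ : End ℂ U) = a • (u k : End ℂ U))
    (horth : ∀ (φ : Dual ℂ U) (f f' : U),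
      ∑ i, φ ((↑(u i)⁻¹ : End ℂ U) f') • (u i : End ℂ U) f = (c * φ f) • f') :
    IsIntegral ℤ c := by
  have hd : finrank ℂ U ≠ 0 := finrank_pos.ne'
  have hdet (i) : LinearMap.det (↑(u i)⁻¹ : End ℂ U) * LinearMap.det (u i : End ℂ U) = 1 := by
    rw [← map_mul, Units.inv_mul, map_one]
  have hsc (i) : ∃ a : ℂ, a ^ finrank ℂ U = LinearMap.det (↑(u i)⁻¹ : End ℂ U) :=
    IsAlgClosed.exists_pow_nat_eq _ (Nat.pos_of_ne_zero hd)
  choose a ha using hsc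
  have ha0 (i) : a i ≠ 0 := by
    rintro h
    have := hdet i
    rw [← ha, h, zero_pow hd, zero_mul] at this
    exact zero_ne_one this
  let S : Set (End ℂ U) :=
    {x | LinearMap.det x = 1 ∧ ∃ i, ∃ b : ℂ, x = b • (u i : End ℂ U)}
  have hS : S.Finite := by
    refine (Set.Finite.image2 (fun (z : ℂ) i ↦ (z * a i) • (u i : End ℂ U))
      (s := ↑(Polynomial.nthRootsFinset (finrank ℂ U) (1 : ℂ))) (Finset.finite_toSet _)
      (Set.finite_univ (α := ι))).subset ?_
    rintro x ⟨hx, i, b, rfl⟩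
    refine ⟨b / a i, ?_, i, trivial, ?_⟩
    · rw [Finset.mem_coe, Polynomial.mem_nthRootsFinset (Nat.pos_of_ne_zero hd), div_pow, ha]
      rw [LinearMap.det_smul] at hx
      have h1 := hdet i
      rw [div_eq_iff (left_ne_zero_of_mul_eq_one h1), one_mul]
      exact mul_right_cancel₀ (right_ne_zero_of_mul_eq_one h1) (hx.trans h1.symm)
    · simp [div_mul_cancel₀ _ (ha0 i)]
  have hSmul : S * S ⊆ S := by
    rintro _ ⟨x, ⟨hx, i, b, rfl⟩, y, ⟨hy, j, b', rfl⟩, rfl⟩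
    refine ⟨by rw [map_mul, hx, hy, one_mul], ?_⟩
    obtain ⟨k, e, he⟩ := hmul i j
    exact ⟨k, b * b' * e, (smul_mul_smul_comm _ _ _ _).trans (by rw [he, smul_smul])⟩
  have hw (i) : a i • (u i : End ℂ U) ∈ S :=
    ⟨by rw [LinearMap.det_smul, ha, hdet], i, _, rfl⟩
  have hw' (i) : (a i)⁻¹ • (↑(u i)⁻¹ : End ℂ U) ∈ S := by
    refine ⟨?_, ?_⟩
    · rw [LinearMap.det_smul, inv_pow, ha, inv_mul_cancel₀ (left_ne_zero_of_mul_eq_one (hdet i))]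
    · obtain ⟨k, e, he⟩ := hinv i
      exact ⟨k, (a i)⁻¹ * e, by rw [he, smul_smul]⟩
  let b := finBasis ℂ U
  have horth' (φ : Dual ℂ U) (f f' : U) :
      ∑ i, φ ((u i : End ℂ U) f) • (↑(u i)⁻¹ : End ℂ U) f' = (c * φ f') • f := by
    refine (forall_dual_apply_eq_zero_iff ℂ _).1 (fun ψ ↦ ?_) |> sub_eq_zero.1
    have := congr_arg φ (horth ψ f f')
    simp only [map_sum, map_smul, smul_eq_mul, map_sub] at this ⊢
    rw [sub_eq_zero]
    calc _ = ∑ i, ψ ((↑(u i)⁻¹ : End ℂ U) f') * φ ((u i : End ℂ U) f) :=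
          Finset.sum_congr rfl fun i _ ↦ mul_comm _ _
      _ = _ := by rw [this]; ring
  have hcomm : (c ^ 2) • (1 : End ℂ U) =
      ∑ j, ∑ i, (u i * u j * ↑(u i)⁻¹ * ↑(u j)⁻¹ : End ℂ U) := by
    ext f
    have key (j : ι) (f' : U) : ∑ i, (u i : End ℂ U) ((u j : End ℂ U) ((↑(u i)⁻¹ : End ℂ U) f')) =
        ∑ l, (c * b.coord l ((u j : End ℂ U) (b l))) • f' := by
      simp_rw [← horth]
      rw [Finset.sum_comm]
      refine Finset.sum_congr rfl fun i _ ↦ ?_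
      conv_lhs => rw [← b.sum_repr ((↑(u i)⁻¹ : End ℂ U) f'), map_sum, map_sum]
      simp only [map_smul, Basis.coord_apply]
    simp only [LinearMap.smul_apply, End.one_apply, LinearMap.sum_apply, End.mul_apply]
    simp_rw [key]
    rw [Finset.sum_comm]
    simp_rw [mul_smul, ← Finset.smul_sum, horth']
    conv_lhs => rw [← b.sum_repr f]
    simp only [Finset.smul_sum, smul_smul, pow_two, Basis.coord_apply, mul_assoc]
  have hmem {x y} (hx : x ∈ Submodule.span ℤ S) (hy : y ∈ Submodule.span ℤ S) :
      x * y ∈ Submodule.span ℤ S := by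
    have := Submodule.mul_mem_mul hx hy
    rw [Submodule.span_mul_span] at this
    exact Submodule.span_mono hSmul this
  have hc : (c ^ 2) • (1 : End ℂ U) ∈ Submodule.span ℤ S := by
    rw [hcomm]
    refine Submodule.sum_mem _ fun j _ ↦ Submodule.sum_mem _ fun i _ ↦ ?_
    have : (u i * u j * ↑(u i)⁻¹ * ↑(u j)⁻¹ : End ℂ U) = (a i • (u i : End ℂ U)) *
        (a j • (u j : End ℂ U)) * ((a i)⁻¹ • (↑(u i)⁻¹ : End ℂ U)) *
        ((a j)⁻¹ • (↑(u j)⁻¹ : End ℂ U)) := by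
      simp only [smul_mul_smul_comm]
      rw [show a i * a j * (a i)⁻¹ * (a j)⁻¹ = 1 by field_simp [ha0 i, ha0 j], one_smul]
    rw [this]
    exact hmem (hmem (hmem (Submodule.subset_span (hw i)) (Submodule.subset_span (hw j)))
      (Submodule.subset_span (hw' i))) (Submodule.subset_span (hw' j))
  by_cases hι : IsEmpty ι
  · have : c ^ 2 = 0 := by
      have h := hcomm
      rw [Finset.sum_of_isEmpty] at h
      exact (smul_eq_zero.1 h).resolve_right one_ne_zero
    rw [pow_eq_zero_iff two_ne_zero] at this
    exact this ▸ isIntegral_zero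
  obtain ⟨i⟩ := not_isEmpty_iff.1 hι
  refine IsIntegral.of_pow two_pos (isIntegral_of_smul_mem_submodule (M := End ℂ U)
    (Submodule.span ℤ S) ?_ (Submodule.fg_span hS) _ fun x hx ↦ ?_)
  · refine (Submodule.ne_bot_iff _).2 ⟨_, Submodule.subset_span (hw i), ?_⟩
    exact smul_ne_zero (ha0 i) (u i).ne_zero
  · simpa using hmem hc hx

namespace Representation

variable {G V W W' W'' : Type*} [Group G] {N : Subgroup G} [N.Normal]
  [AddCommGroup V] [Module ℂ V] [AddCommGroup W] [Module ℂ W]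
  [AddCommGroup W'] [Module ℂ W'] [AddCommGroup W''] [Module ℂ W'']

/-- The linear map `s` intertwines `σ` with the twist of `τ` by conjugation with `g`. -/
def IsConjIntertwining (σ : Representation ℂ N W) (τ : Representation ℂ N W') (g : G)
    (s : W →ₗ[ℂ] W') : Prop :=
  ∀ n w, s (σ n w) = τ (MulAut.conjNormal g n) (s w)

namespace IsConjIntertwining

variable {σ : Representation ℂ N W} {τ : Representation ℂ N W'} {υ : Representation ℂ N W''}

theorem comp {g h : G} {s : W →ₗ[ℂ] W'} {t : W' →ₗ[ℂ] W''} (ht : IsConjIntertwining τ υ g t)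
    (hs : IsConjIntertwining σ τ h s) : IsConjIntertwining σ υ (g * h) (t ∘ₗ s) := fun n w ↦ by
  simp [hs n w, ht _ _]

theorem symm {g : G} {s : W ≃ₗ[ℂ] W'} (hs : IsConjIntertwining σ τ g s) :
    IsConjIntertwining τ σ g⁻¹ s.symm := fun n w ↦ by
  apply s.injective
  have := hs (MulAut.conjNormal g⁻¹ n) (s.symm w)
  simp only [LinearEquiv.coe_coe] at this ⊢
  rw [this]
  simp

theorem self_apply (σ : Representation ℂ N W) (n : N) : IsConjIntertwining σ σ n (σ n) :=
  fun m w ↦ by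
  simp [← End.mul_apply, ← map_mul, MulAut.conjNormal_val]

theorem of_restrict {ρ : Representation ℂ G V} (g : G) {f : W →ₗ[ℂ] V} {π : V →ₗ[ℂ] W'}
    (hf : ∀ n w, f (σ n w) = ρ n (f w)) (hπ : ∀ (n : N) v, π (ρ n v) = τ n (π v)) :
    IsConjIntertwining σ τ g (π ∘ₗ ρ g ∘ₗ f) := fun n w ↦ by
  simp only [LinearMap.comp_apply, hf, ← hπ]
  simp only [← End.mul_apply, ← map_mul, MulAut.conjNormal_apply]
  simp

theorem bijective_or_eq_zero {g : G} {s : W →ₗ[ℂ] W'} (hs : IsConjIntertwining σ τ g s)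
    [IsIrreducible σ] [IsIrreducible τ] : Function.Bijective s ∨ s = 0 := by
  by_cases h0 : s = 0
  · exact .inr h0
  refine .inl ⟨?_, ?_⟩
  · let K : Subrepresentation σ := ⟨LinearMap.ker s, fun n w hw ↦ by
      rw [LinearMap.mem_ker] at hw ⊢
      rw [hs, hw, map_zero]⟩
    rcases eq_bot_or_eq_top K with h | h
    · exact LinearMap.ker_eq_bot.1 (congr_arg Subrepresentation.toSubmodule h)
    · exact absurd (LinearMap.ker_eq_top.1 (congr_arg Subrepresentation.toSubmodule h)) h0
  · let R : Subrepresentation τ := ⟨LinearMap.range s, fun n w ↦ by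
      rintro ⟨v, rfl⟩
      exact ⟨σ (MulAut.conjNormal g⁻¹ n) v, by rw [hs]; simp⟩⟩
    rcases eq_bot_or_eq_top R with h | h
    · exact absurd (LinearMap.range_eq_bot.1 (congr_arg Subrepresentation.toSubmodule h)) h0
    · exact LinearMap.range_eq_top.1 (congr_arg Subrepresentation.toSubmodule h)

end IsConjIntertwining

theorem IsIrreducible.nontrivial {H : Type*} [Group H] (σ : Representation ℂ H W)
    [IsIrreducible σ] : Nontrivial W := by
  by_contra h
  rw [not_nontrivial_iff_subsingleton] at h
  exact bot_ne_top (α := Subrepresentation σ) (Subrepresentation.ext (Subsingleton.elim _ _))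

theorem IsIrreducible.exists_eq_smul_one {H : Type*} [Group H] [FiniteDimensional ℂ W]
    {σ : Representation ℂ H W} [IsIrreducible σ] (s : W →ₗ[ℂ] W)
    (hs : ∀ n w, s (σ n w) = σ n (s w)) : ∃ a : ℂ, s = a • 1 := by
  let F : IntertwiningMap σ σ := LinearMap.intertwiningMap_of_isIntertwiningMap σ σ s hs
  obtain ⟨a, ha⟩ := (algebraMap_intertwiningMap_bijective_of_isAlgClosed (ρ := σ)).2 F
  refine ⟨a, LinearMap.ext fun w ↦ ?_⟩
  exact (DFunLike.congr_fun ha w).symm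

theorem IsConjIntertwining.exists_eq_smul [FiniteDimensional ℂ W] {σ : Representation ℂ N W}
    [IsIrreducible σ] {g : G} {s : W →ₗ[ℂ] W} {t : W ≃ₗ[ℂ] W} (hs : IsConjIntertwining σ σ g s)
    (ht : IsConjIntertwining σ σ g t) : ∃ a : ℂ, s = a • t.toLinearMap := by
  obtain ⟨a, ha⟩ := IsIrreducible.exists_eq_smul_one (σ := σ) (t.symm.toLinearMap ∘ₗ s) fun n w ↦ by
    simpa using ht.symm.comp hs n w
  refine ⟨a, LinearMap.ext fun w ↦ ?_⟩
  have := congr_arg t (LinearMap.congr_fun ha w)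
  simpa using this

omit [N.Normal] in
/-- An injective `N`-equivariant map has an `N`-equivariant left inverse up to a nonzero scalar. -/
theorem exists_restrict_leftInverse [Fintype N] {σ : Representation ℂ N W} {ρ : Representation ℂ G V}
    {f : W →ₗ[ℂ] V} (hf : ∀ n w, f (σ n w) = ρ n (f w)) (hinj : Function.Injective f) :
    ∃ π : V →ₗ[ℂ] W, (∀ (n : N) v, π (ρ n v) = σ n (π v)) ∧
      π ∘ₗ f = (Fintype.card N : ℂ) • 1 := by
  obtain ⟨p, hp⟩ := f.exists_leftInverse_of_injective (LinearMap.ker_eq_bot.2 hinj)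
  refine ⟨∑ m : N, σ m ∘ₗ p ∘ₗ ρ (m⁻¹ : N), fun n v ↦ ?_, LinearMap.ext fun w ↦ ?_⟩
  · simp only [LinearMap.sum_apply, LinearMap.comp_apply, map_sum]
    refine Fintype.sum_equiv (Equiv.mulLeft n⁻¹) _ _ fun m ↦ ?_
    simp [← End.mul_apply, ← map_mul]
  · have h (w) : p (f w) = w := LinearMap.congr_fun hp w
    simp only [LinearMap.sum_apply, LinearMap.comp_apply, ← hf, h]
    simp [← End.mul_apply, ← map_mul, Nat.cast_smul_eq_nsmul]

omit [N.Normal] in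
/-- Summing the conjugates of an `N`-equivariant endomorphism over `G ⧸ N` yields a scalar. -/
theorem sum_quotient_conj [Fintype (G ⧸ N)] [FiniteDimensional ℂ V] (ρ : Representation ℂ G V)
    [IsIrreducible ρ] (y : V →ₗ[ℂ] V) (hy : ∀ (n : N) v, y (ρ n v) = ρ n (y v)) :
    ∑ h : G ⧸ N, ρ h.out ∘ₗ y ∘ₗ ρ h.out⁻¹ =
      ((Fintype.card (G ⧸ N) : ℂ) * LinearMap.trace ℂ V y / finrank ℂ V) • 1 := by
  have hout (g : G) : ρ (g : G ⧸ N).out ∘ₗ y ∘ₗ ρ (g : G ⧸ N).out⁻¹ = ρ g ∘ₗ y ∘ₗ ρ g⁻¹ := by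
    obtain ⟨n, hn⟩ := QuotientGroup.mk_out_eq_mul N g
    rw [hn]
    ext v
    simp only [mul_inv_rev, map_mul, LinearMap.comp_apply, End.mul_apply]
    rw [← hy, ← End.mul_apply (ρ n), ← map_mul]
    simp
  obtain ⟨a, ha⟩ := IsIrreducible.exists_eq_smul_one (σ := ρ)
    (∑ h : G ⧸ N, ρ h.out ∘ₗ y ∘ₗ ρ h.out⁻¹) fun g v ↦ by
      simp only [LinearMap.sum_apply, map_sum]
      refine Fintype.sum_equiv (MulAction.toPerm g⁻¹) _ _ fun h ↦ ?_
      induction h using QuotientGroup.induction_on with | _ h =>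
      rw [MulAction.toPerm_apply, MulAction.Quotient.smul_coe, hout, hout]
      have hρ (a b : G) (v : V) : ρ a (ρ b v) = ρ (a * b) v := by rw [map_mul, End.mul_apply]
      simp only [LinearMap.comp_apply, hρ, smul_eq_mul, mul_inv_rev, inv_inv, mul_inv_cancel_left]
  have htr := congr_arg (LinearMap.trace ℂ V) ha
  rw [map_sum, map_smul, LinearMap.trace_one] at htr
  have hV : (finrank ℂ V : ℂ) ≠ 0 := by
    have := IsIrreducible.nontrivial ρ
    exact_mod_cast finrank_pos.ne'
  rw [ha]
  congr 1
  rw [eq_div_iff hV, ← smul_eq_mul a, ← htr]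
  have (h : G ⧸ N) : LinearMap.trace ℂ V (ρ h.out ∘ₗ y ∘ₗ ρ h.out⁻¹) = LinearMap.trace ℂ V y := by
    rw [LinearMap.trace_comp_comm', LinearMap.comp_assoc]
    change LinearMap.trace ℂ V (y * (ρ _ * ρ _)) = _
    rw [← map_mul]; simp
  simp [this]

/-- The space of `N`-equivariant maps from `σ` to the restriction of `ρ`. -/
def restrictHom (σ : Representation ℂ N W) (ρ : Representation ℂ G V) :
    Submodule ℂ (W →ₗ[ℂ] V) where
  carrier := {f | ∀ n w, f (σ n w) = ρ n (f w)}
  zero_mem' := by simp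
  add_mem' hf hf' n w := by simp [hf n w, hf' n w]
  smul_mem' a f hf n w := by simp [hf n w]

/-- The endomorphism `f ↦ ρ g ∘ f ∘ s` of the space of `N`-equivariant maps. -/
def restrictHomConj {σ : Representation ℂ N W} (ρ : Representation ℂ G V) {g : G} {s : W →ₗ[ℂ] W}
    (hs : IsConjIntertwining σ σ g⁻¹ s) : End ℂ (restrictHom σ ρ) where
  toFun f := ⟨ρ g ∘ₗ f.1 ∘ₗ s, fun n w ↦ by
    simp only [LinearMap.comp_apply]
    rw [hs, f.2, ← End.mul_apply, ← map_mul, ← End.mul_apply, ← map_mul, MulAut.conjNormal_apply]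
    simp⟩
  map_add' f f' := by ext; simp
  map_smul' a f := by ext; simp

variable {σ : Representation ℂ N W} {ρ : Representation ℂ G V}

/-- Up to a scalar, `restrictHomConj` only depends on the coset `g N`. -/
theorem exists_coset_of_isConjIntertwining [FiniteDimensional ℂ W] [IsIrreducible σ]
    {g : G} (t : W ≃ₗ[ℂ] W) (ht : IsConjIntertwining σ σ g⁻¹ t) :
    ∃ h : G ⧸ N, (∃ s : W ≃ₗ[ℂ] W, IsConjIntertwining σ σ h.out⁻¹ s) ∧
      ∀ (s : W ≃ₗ[ℂ] W) (hs : IsConjIntertwining σ σ h.out⁻¹ s),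
        ∃ a : ℂ, restrictHomConj ρ ht = a • restrictHomConj ρ hs := by
  obtain ⟨n, hn⟩ := QuotientGroup.mk_out_eq_mul N g
  have hn' : (g : G ⧸ N).out⁻¹ = (n⁻¹ : N) * g⁻¹ := by rw [hn]; simp
  have hσ : (σ n⁻¹ * σ n = 1) ∧ (σ n * σ n⁻¹ = 1) := by simp [← map_mul]
  let e : W ≃ₗ[ℂ] W := LinearEquiv.ofLinearMap (σ n⁻¹) (σ n) hσ.1 hσ.2
  have he : IsConjIntertwining σ σ (g : G ⧸ N).out⁻¹ (t.trans e : W ≃ₗ[ℂ] W) :=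
    hn' ▸ (IsConjIntertwining.self_apply σ n⁻¹).comp ht
  refine ⟨g, ⟨_, he⟩, fun s hs ↦ ?_⟩
  obtain ⟨a, ha⟩ := he.exists_eq_smul hs
  refine ⟨a, LinearMap.ext fun f ↦ Subtype.ext <| LinearMap.ext fun w ↦ ?_⟩
  have h1 : a • s w = σ n⁻¹ (t w) := (LinearMap.congr_fun ha w).symm
  change ρ g (f.1 (t w)) = a • ρ (g : G ⧸ N).out (f.1 (s w))
  rw [← map_smul, ← map_smul, h1, f.2, hn, ← End.mul_apply, ← map_mul]
  simp

omit [N.Normal] in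
/-- Every linear form on the space of `N`-equivariant maps `W → V` is given by composition with
an `N`-equivariant map `V → W`. -/
theorem exists_comp_eq_dual_smul [Fintype N] [FiniteDimensional ℂ V] [FiniteDimensional ℂ W]
    [IsIrreducible σ] (φ : Dual ℂ (restrictHom σ ρ)) :
    ∃ π : V →ₗ[ℂ] W, (∀ (n : N) v, π (ρ n v) = σ n (π v)) ∧
      ∀ f : restrictHom σ ρ, π ∘ₗ f.1 = φ f • 1 := by
  let K : Submodule ℂ (Dual ℂ (restrictHom σ ρ)) :=
    { carrier := {φ | ∃ π : V →ₗ[ℂ] W, (∀ (n : N) v, π (ρ n v) = σ n (π v)) ∧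
        ∀ f : restrictHom σ ρ, π ∘ₗ f.1 = φ f • 1}
      zero_mem' := ⟨0, by simp, by simp⟩
      add_mem' := by
        rintro φ φ' ⟨π, h, h'⟩ ⟨π', k, k'⟩
        exact ⟨π + π', fun n v ↦ by simp [h, k], fun f ↦ by
          rw [LinearMap.add_comp, h', k', LinearMap.add_apply, add_smul]⟩
      smul_mem' := by
        rintro a φ ⟨π, h, h'⟩
        exact ⟨a • π, fun n v ↦ by simp [h], fun f ↦ by
          rw [LinearMap.smul_comp, h', LinearMap.smul_apply, smul_assoc]⟩ }
  suffices h : Submodule.span ℂ (K : Set (Dual ℂ (restrictHom σ ρ))) = ⊤ by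
    rw [Submodule.span_eq] at h
    exact (h ▸ Submodule.mem_top : φ ∈ K)
  have := IsIrreducible.nontrivial σ
  have hW : (finrank ℂ W : ℂ) ≠ 0 := by exact_mod_cast finrank_pos.ne'
  refine Submodule.span_eq_top_of_ne_zero fun f hf ↦ ?_
  let F : IntertwiningMap σ (ρ.comp N.subtype) := ⟨f.1, fun n ↦ LinearMap.ext (f.2 n)⟩
  have hF : Function.Injective f.1 := by
    refine (IsIrreducible.injective_or_eq_zero F).resolve_right fun h ↦ hf ?_
    exact Subtype.ext (congr_arg IntertwiningMap.toLinearMap h)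
  obtain ⟨π, hπ, hπf⟩ := exists_restrict_leftInverse f.2 hF
  let ψ : Dual ℂ (restrictHom σ ρ) := (finrank ℂ W : ℂ)⁻¹ •
    (LinearMap.trace ℂ W ∘ₗ LinearMap.llcomp ℂ W V W π ∘ₗ (restrictHom σ ρ).subtype)
  have hψ (f : restrictHom σ ρ) : ψ f = (finrank ℂ W : ℂ)⁻¹ * LinearMap.trace ℂ W (π ∘ₗ f.1) := rfl
  refine ⟨ψ, ⟨π, hπ, fun f ↦ ?_⟩, ?_⟩
  · obtain ⟨a, ha⟩ := IsIrreducible.exists_eq_smul_one (σ := σ) (π ∘ₗ f.1) fun n w ↦ by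
      simp [f.2 n w, hπ]
    rw [hψ, ha, map_smul, LinearMap.trace_one, smul_eq_mul, mul_comm a, inv_mul_cancel_left₀ hW]
  · rw [hψ, hπf, map_smul, LinearMap.trace_one]
    simp [hW]

/-- If `ρ` is an irreducible representation of `G` and `σ` is an irreducible constituent of its
restriction to `N`, then `|G : N| dim σ / dim ρ` is an algebraic integer. -/
theorem isIntegral_index_mul_finrank_div [Finite G] [FiniteDimensional ℂ V] [FiniteDimensional ℂ W]
    [IsIrreducible ρ] [IsIrreducible σ] [Nontrivial (restrictHom σ ρ)] :
    IsIntegral ℤ ((N.index : ℂ) * finrank ℂ W / finrank ℂ V) := by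
  classical
  have := Fintype.ofFinite G
  have := Fintype.ofFinite N
  have := Fintype.ofFinite (G ⧸ N)
  let ι := {h : G ⧸ N // ∃ s : W ≃ₗ[ℂ] W, IsConjIntertwining σ σ h.out⁻¹ s}
  choose s hs using fun i : ι ↦ i.2
  have hs' (i : ι) : IsConjIntertwining σ σ (i.1.out⁻¹)⁻¹ (s i).symm := (hs i).symm
  have hρ (a b : G) (v : V) : ρ a (ρ b v) = ρ (a * b) v := by rw [map_mul, End.mul_apply]
  let u (i : ι) : (End ℂ (restrictHom σ ρ))ˣ :=
    { val := restrictHomConj ρ (hs i)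
      inv := restrictHomConj ρ (hs' i)
      val_inv := by
        ext f w
        change ρ _ (ρ _ (f.1 ((s i).symm (s i w)))) = f.1 w
        simp [hρ, -map_mul]
      inv_val := by
        ext f w
        change ρ _ (ρ _ (f.1 (s i ((s i).symm w)))) = f.1 w
        simp [hρ, -map_mul] }
  refine isIntegral_of_sum_units_conj u _ (fun i j ↦ ?_) (fun i ↦ ?_) fun φ f f' ↦ ?_
  · have h : IsConjIntertwining σ σ (i.1.out * j.1.out)⁻¹ ((s i).trans (s j) : W ≃ₗ[ℂ] W) := by
      rw [mul_inv_rev]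
      exact (hs j).comp (hs i)
    obtain ⟨k, hk, hk'⟩ := exists_coset_of_isConjIntertwining (ρ := ρ) _ h
    obtain ⟨a, ha⟩ := hk' _ (hs ⟨k, hk⟩)
    refine ⟨⟨k, hk⟩, a, ha ▸ ?_⟩
    ext f w
    exact hρ _ _ _
  · obtain ⟨k, hk, hk'⟩ := exists_coset_of_isConjIntertwining (ρ := ρ) _ (hs' i)
    obtain ⟨a, ha⟩ := hk' _ (hs ⟨k, hk⟩)
    exact ⟨⟨k, hk⟩, a, ha⟩
  · obtain ⟨π, hπ, hπφ⟩ := exists_comp_eq_dual_smul φ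
    have hπφ' (f : restrictHom σ ρ) (w : W) : π (f.1 w) = φ f • w :=
      LinearMap.congr_fun (hπφ f) w
    have hsum := sum_quotient_conj (N := N) ρ (f.1 ∘ₗ π) fun n v ↦ by
      simp only [LinearMap.comp_apply, hπ, f.2 n]
    have htr : LinearMap.trace ℂ V (f.1 ∘ₗ π) = φ f * finrank ℂ W := by
      rw [LinearMap.trace_comp_comm', hπφ, map_smul, LinearMap.trace_one, smul_eq_mul]
    rw [htr] at hsum
    ext w
    have hw := LinearMap.congr_fun hsum (f'.1 w)
    rw [LinearMap.sum_apply] at hw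
    have hcard : (N.index : ℂ) = Fintype.card (G ⧸ N) := by
      rw [Subgroup.index, Nat.card_eq_fintype_card]
    have hrhs : ((N.index : ℂ) * finrank ℂ W / finrank ℂ V * φ f) • f'.1 w =
        (((Fintype.card (G ⧸ N) : ℂ) * (φ f * finrank ℂ W) / finrank ℂ V) • (1 : End ℂ V))
          (f'.1 w) := by
      rw [hcard, LinearMap.smul_apply, End.one_apply]
      congr 1
      ring
    rw [Submodule.coe_smul, LinearMap.smul_apply, hrhs, ← hw, Submodule.coe_sum,
      LinearMap.sum_apply]
    refine Fintype.sum_of_injective (Subtype.val : ι → G ⧸ N) Subtype.val_injective _ _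
      (fun h hh ↦ ?_) fun i ↦ ?_
    · have hT := IsConjIntertwining.of_restrict (ρ := ρ) h.out⁻¹ f'.2 hπ
      rcases hT.bijective_or_eq_zero with hb | h0
      · exact absurd ⟨⟨h, LinearEquiv.ofBijective _ hb, hT⟩, rfl⟩ hh
      · have : π (ρ h.out⁻¹ (f'.1 w)) = 0 := LinearMap.congr_fun h0 w
        simp only [LinearMap.comp_apply, this, map_zero]
    · have h1 := hπφ' ((↑(u i)⁻¹ : End ℂ (restrictHom σ ρ)) f') (s i w)
      have h2 : ((↑(u i)⁻¹ : End ℂ (restrictHom σ ρ)) f').1 (s i w) =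
          ρ i.1.out⁻¹ (f'.1 ((s i).symm (s i w))) := rfl
      rw [h2, LinearEquiv.symm_apply_apply] at h1
      simp only [LinearMap.comp_apply, h1, map_smul]
      rfl

/-- Any two irreducible constituents of the restriction of an irreducible representation to a
normal subgroup have the same dimension. -/
theorem finrank_eq_of_restrictHom [Finite G] [IsIrreducible ρ]
    {τ : Representation ℂ N W'} [IsIrreducible σ] [IsIrreducible τ]
    [Nontrivial (restrictHom σ ρ)] [Nontrivial (restrictHom τ ρ)] :
    finrank ℂ W = finrank ℂ W' := by
  have := Fintype.ofFinite N
  obtain ⟨f, hf⟩ := exists_ne (0 : restrictHom σ ρ)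
  obtain ⟨f', hf'⟩ := exists_ne (0 : restrictHom τ ρ)
  let F : IntertwiningMap τ (ρ.comp N.subtype) := ⟨f'.1, fun n ↦ LinearMap.ext (f'.2 n)⟩
  have hF : Function.Injective f'.1 := by
    refine (IsIrreducible.injective_or_eq_zero F).resolve_right fun h ↦ hf' ?_
    exact Subtype.ext (congr_arg IntertwiningMap.toLinearMap h)
  obtain ⟨π, hπ, hπf⟩ := exists_restrict_leftInverse f'.2 hF
  have hg (g : G) := IsConjIntertwining.of_restrict (ρ := ρ) g f.2 hπ
  by_cases h : ∃ g, π ∘ₗ ρ g ∘ₗ f.1 ≠ 0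
  · obtain ⟨g, h⟩ := h
    exact (LinearEquiv.ofBijective _ ((hg g).bijective_or_eq_zero.resolve_right h)).finrank_eq
  · push Not at h
    exfalso
    let K : Subrepresentation ρ := ⟨⨅ g, LinearMap.ker (π ∘ₗ ρ g), fun g v hv ↦ by
      simp only [Submodule.mem_iInf, LinearMap.mem_ker, LinearMap.comp_apply] at hv ⊢
      intro h
      rw [← End.mul_apply, ← map_mul]
      exact hv _⟩
    have hK {v : V} : v ∈ K.toSubmodule ↔ ∀ g, π (ρ g v) = 0 := by
      simp [K, Submodule.mem_iInf]
    rcases eq_bot_or_eq_top K with hb | ht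
    · refine hf (Subtype.ext (LinearMap.ext fun w ↦ ?_))
      have hm : f.1 w ∈ K.toSubmodule := hK.2 fun g ↦ LinearMap.congr_fun (h g) w
      rw [hb] at hm
      exact (Submodule.mem_bot ℂ).1 hm
    · have := IsIrreducible.nontrivial τ
      obtain ⟨w, hw⟩ := exists_ne (0 : W')
      have hm : f'.1 w ∈ K.toSubmodule := by rw [ht]; exact Submodule.mem_top
      have h1 := hK.1 hm 1
      have h2 := LinearMap.congr_fun hπf w
      simp only [map_one, End.one_apply] at h1
      simp [h1] at h2
      exact hw ((smul_eq_zero.1 h2.symm).resolve_left (by exact_mod_cast Fintype.card_ne_zero))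

end Representation

namespace FDRep

open Representation

/-- A simple object of `FDRep ℂ H` is an irreducible representation. -/
theorem isIrreducible_of_simple {H : Type} [Group H] (V : FDRep ℂ H) [Simple V] :
    IsIrreducible V.ρ := by
  have hsub (p : Subrepresentation V.ρ) : p = ⊥ ∨ p = ⊤ := by
    let i : FDRep.of p.toRepresentation ⟶ V :=
      forget₂HomLinearEquiv _ _ (Rep.ofHom ⟨p.toSubmodule.subtype, fun g ↦ rfl⟩)
    have hi (x : p.toSubmodule) : i x = (x : V) := rfl
    have : Mono i := ConcreteCategory.mono_of_injective i fun x y h ↦ Subtype.ext h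
    by_cases h : i = 0
    · left
      refine Subrepresentation.toSubmodule_injective ((Submodule.eq_bot_iff _).2 fun x hx ↦ ?_)
      refine (hi ⟨x, hx⟩).symm.trans ?_
      rw [h]
      rfl
    · right
      have := (Simple.mono_isIso_iff_nonzero i).2 h
      refine Subrepresentation.toSubmodule_injective ((Submodule.eq_top_iff').2 fun x ↦ ?_)
      obtain ⟨y, rfl⟩ := (isoToLinearEquiv (asIso i)).surjective x
      exact y.2
  have hne : (⊥ : Subrepresentation V.ρ) ≠ ⊤ := fun h ↦ by
    refine id_nonzero V ?_
    ext x
    have hx : x ∈ (⊥ : Subrepresentation V.ρ).toSubmodule := h ▸ Submodule.mem_top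
    exact (Submodule.mem_bot ℂ).1 hx
  exact { exists_pair_ne := ⟨_, _, hne⟩, eq_bot_or_eq_top := hsub }

/-- The dimension of the space of morphisms `U ⟶ V` is additive in the character of `V`. -/
theorem finrank_hom_eq_sum {H : Type} [Group H] [Fintype H] {ι : Type*} [Fintype ι]
    (U V : FDRep ℂ H) (θ : ι → FDRep ℂ H) (h : ∀ x, V.character x = ∑ i, (θ i).character x) :
    finrank ℂ (U ⟶ V) = ∑ i, finrank ℂ (U ⟶ θ i) := by
  have : Invertible (Nat.card H : ℂ) := invertibleOfNonzero (by simp)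
  apply Nat.cast_injective (R := ℂ)
  rw [Nat.cast_sum, ← scalar_product_char_eq_finrank_equivariant]
  simp_rw [← scalar_product_char_eq_finrank_equivariant, h, Finset.sum_mul, ← Finset.mul_sum]
  rw [Finset.sum_comm]

/-- A nonzero morphism to the restriction of `V` is a nonzero element of `restrictHom`. -/
theorem nontrivial_restrictHom {G : Type} [Group G] (N : Subgroup G) (V : FDRep ℂ G)
    (W : FDRep ℂ N) (h : finrank ℂ (W ⟶ FDRep.res N V) ≠ 0) :
    Nontrivial (restrictHom W.ρ V.ρ) := by
  have := nontrivial_of_finrank_pos (Nat.pos_of_ne_zero h)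
  obtain ⟨f, hf⟩ := exists_ne (0 : W ⟶ FDRep.res N V)
  let F := ((forget₂HomLinearEquiv _ _).symm f).hom
  refine nontrivial_of_ne (⟨F.toLinearMap, fun n w ↦ LinearMap.congr_fun (F.2 n) w⟩ :
    restrictHom W.ρ V.ρ) 0 fun h0 ↦ hf ?_
  ext x
  exact LinearMap.congr_fun (congr_arg Subtype.val h0) x

end FDRep

/-- If the quotient of two natural numbers is an algebraic integer, then it is an integer. -/
theorem Nat.dvd_of_isIntegral_div {a b : ℕ} (hb : b ≠ 0) (h : IsIntegral ℤ (a / b : ℂ)) :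
    b ∣ a := by
  have h' : IsIntegral ℤ (algebraMap ℚ ℂ (a / b)) := by simpa using h
  rw [isIntegral_algebraMap_iff (algebraMap ℚ ℂ).injective,
    IsIntegrallyClosed.isIntegral_iff] at h'
  obtain ⟨c, hc⟩ := h'
  rw [eq_div_iff (by exact_mod_cast hb), eq_intCast] at hc
  refine Int.natCast_dvd_natCast.1 ⟨c, ?_⟩
  rw [mul_comm]
  exact_mod_cast hc.symm

/-- If `G` is a finite group, `N ⊴ G`, `χ` is an irreducible complex character of `G`, and
`χ|_N = θ₁ + ⋯ + θ_k` with each `θᵢ` irreducible in `N`, then `k` divides `|G : N|`. -/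
theorem restriction_decomposition_card_dvd_index
    {G : Type} [Group G] [Fintype G] (N : Subgroup G) [N.Normal]
    (V : FDRep ℂ G) (hV : Simple V) (k : ℕ) (θ : Fin k → FDRep ℂ N)
    (hθ : ∀ i, Simple (θ i))
    (hdec : ∀ n : N, (FDRep.res N V).character n = ∑ i, (θ i).character n) :
    k ∣ N.index := by
  have := Fintype.ofFinite N
  have hVirr := V.isIrreducible_of_simple
  have hθirr (i) := (θ i).isIrreducible_of_simple
  have hnt (i) : Nontrivial (Representation.restrictHom (θ i).ρ V.ρ) := by
    refine FDRep.nontrivial_restrictHom N V (θ i) ?_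
    rw [FDRep.finrank_hom_eq_sum _ _ θ hdec]
    refine fun h ↦ absurd (Finset.sum_eq_zero_iff.1 h i (Finset.mem_univ i)) ?_
    rw [FDRep.finrank_hom_simple_simple, if_pos ⟨Iso.refl _⟩]
    exact one_ne_zero
  have hdim : finrank ℂ V = ∑ i, finrank ℂ (θ i) := by
    have h1 := hdec 1
    simp only [FDRep.char_one] at h1
    exact_mod_cast h1
  have hV0 : 0 < finrank ℂ V :=
    have := Representation.IsIrreducible.nontrivial V.ρ
    finrank_pos
  obtain _ | k := k
  · simp [hdim] at hV0
  have hconst (i) : finrank ℂ (θ i) = finrank ℂ (θ 0) :=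
    Representation.finrank_eq_of_restrictHom (σ := (θ i).ρ) (τ := (θ 0).ρ) (ρ := V.ρ)
  simp only [hconst, Finset.sum_const, Finset.card_univ, Fintype.card_fin, smul_eq_mul] at hdim
  have hd : (finrank ℂ (θ 0) : ℂ) ≠ 0 := by
    have : finrank ℂ (θ 0) ≠ 0 := fun h ↦ by simp [hdim, h] at hV0
    exact_mod_cast this
  refine Nat.dvd_of_isIntegral_div k.succ_ne_zero ?_
  have hint := Representation.isIntegral_index_mul_finrank_div (σ := (θ 0).ρ) (ρ := V.ρ)
  rwa [hdim, Nat.cast_mul, mul_div_mul_right _ _ hd] at hint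
end

section
/- Let G be a finite group and N a normal subgroup such that G/N is solvable and nonabelian, and N is maximal with these properties (i.e., G/N is minimal nonabelian solvable). Then either G/N is an r-group for some prime r, or G/N is a Frobenius group whose Frobenius kernel F/N is elementary abelian of order r^a for some prime r, where a is the smallest positive integer with r^a ≡ 1 (mod |G : F|), and |G : F| is a character degree of G. -/
open CategoryTheory Module

/-- The set of degrees of irreducible complex characters of `G`. -/
noncomputable def charDegrees (G : Type) [Group G] : Set ℕ :=
  {d | ∃ V : FDRep ℂ G, Simple V ∧ finrank ℂ V = d}

/-- `Q` is a Frobenius group with Frobenius kernel `K`. -/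
def IsFrobeniusWithKernel (Q : Type) [Group Q] (K : Subgroup Q) : Prop :=
  K.Normal ∧ K ≠ ⊥ ∧ K ≠ ⊤ ∧
    ∀ x : Q, x ∈ K → x ≠ 1 → Subgroup.centralizer {x} ≤ K

/-- A group is elementary abelian for the prime `r` if it is abelian and every element
has order dividing `r`. -/
def IsElementaryAbelian (r : ℕ) (Q : Type) [Group Q] : Prop :=
  (∀ a b : Q, a * b = b * a) ∧ ∀ x : Q, x ^ r = 1

section InducedRepresentation

variable {Q : Type} [Group Q] {K : Subgroup Q}

/-- The functions `f : Q → ℂ` with `f (x * k) = χ k * f x` for `k ∈ K`: the space of the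
representation of `Q` induced from the linear character `χ` of `K`. -/
def inducedSpace (χ : K →* ℂˣ) : Submodule ℂ (Q → ℂ) where
  carrier := {f | ∀ (x : Q) (k : K), f (x * k) = χ k * f x}
  zero_mem' := by intro x k; simp
  add_mem' := by
    intro f g hf hg x k
    simp only [Pi.add_apply, hf x k, hg x k, mul_add]
  smul_mem' := by
    intro c f hf x k
    simp only [Pi.smul_apply, smul_eq_mul, hf x k]
    ring

/-- The representation on `inducedSpace χ` by left translation, pulled back along `π`. -/
def inducedRepresentation {G : Type} [Group G] (π : G →* Q) (χ : K →* ℂˣ) :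
    Representation ℂ G (inducedSpace χ) where
  toFun g :=
    { toFun := fun f ↦ ⟨fun x ↦ f.1 ((π g)⁻¹ * x), fun x k ↦ by
        simpa only [mul_assoc] using f.2 ((π g)⁻¹ * x) k⟩
      map_add' := fun _ _ ↦ rfl
      map_smul' := fun _ _ ↦ rfl }
  map_one' := by
    ext f x
    simp
  map_mul' g h := by
    ext f x
    simp [mul_assoc]

theorem inducedRepresentation_apply {G : Type} [Group G] (π : G →* Q) (χ : K →* ℂˣ)
    (g : G) (f : inducedSpace χ) (x : Q) :
    (inducedRepresentation π χ g f).1 x = f.1 ((π g)⁻¹ * x) := rfl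

theorem out_inv_mul_mem (x : Q) : ((x : Q ⧸ K).out)⁻¹ * x ∈ K :=
  QuotientGroup.eq.mp (QuotientGroup.out_eq' (x : Q ⧸ K))

/-- An element of `inducedSpace χ` is determined by its values on coset representatives. -/
noncomputable def inducedSpaceEquiv (χ : K →* ℂˣ) : inducedSpace χ ≃ₗ[ℂ] (Q ⧸ K → ℂ) where
  toFun f c := f.1 c.out
  map_add' _ _ := rfl
  map_smul' _ _ := rfl
  invFun φ := ⟨fun x ↦ χ ⟨_, out_inv_mul_mem x⟩ * φ x, fun x k ↦ by
    have h : ((x * k : Q) : Q ⧸ K) = x := QuotientGroup.mk_mul_of_mem x k.2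
    have h' : (⟨_, out_inv_mul_mem (x * k)⟩ : K) = ⟨_, out_inv_mul_mem x⟩ * k := by
      ext
      simp [h, mul_assoc]
    beta_reduce
    rw [h', h, map_mul, Units.val_mul]
    ring⟩
  left_inv f := by
    ext x
    simpa using (f.2 ((x : Q ⧸ K).out) ⟨_, out_inv_mul_mem x⟩).symm
  right_inv φ := by
    ext c
    have h : (⟨_, out_inv_mul_mem c.out⟩ : K) = 1 := by
      ext
      simp
    change (χ ⟨_, out_inv_mul_mem c.out⟩ : ℂ) * φ (c.out : Q) = φ c
    rw [h, map_one, Units.val_one, one_mul, QuotientGroup.out_eq']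

open Classical in
/-- The extension of `χ` by zero, as an element of `inducedSpace χ`. -/
noncomputable def inducedGenerator (χ : K →* ℂˣ) : inducedSpace χ :=
  ⟨fun x ↦ if h : x ∈ K then χ ⟨x, h⟩ else 0, fun x k ↦ by
    beta_reduce
    by_cases hx : x ∈ K
    · have hxk : x * k ∈ K := K.mul_mem hx k.2
      have h : (⟨x * k, hxk⟩ : K) = k * (k⁻¹ * ⟨x, hx⟩ * k) := by ext; simp [mul_assoc]
      rw [dif_pos hxk, dif_pos hx, h, map_mul, map_mul, map_mul, map_inv]
      simp [mul_comm]
    · rw [dif_neg hx, dif_neg (by rwa [K.mul_mem_cancel_right k.2]), mul_zero]⟩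

theorem inducedGenerator_apply_of_mem (χ : K →* ℂˣ) {x : Q} (hx : x ∈ K) :
    (inducedGenerator χ).1 x = χ ⟨x, hx⟩ := dif_pos hx

theorem inducedGenerator_apply_of_notMem (χ : K →* ℂˣ) {x : Q} (hx : x ∉ K) :
    (inducedGenerator χ).1 x = 0 := dif_neg hx

instance [Finite Q] (χ : K →* ℂˣ) : Module.Finite ℂ (inducedSpace χ) := by
  have := Fintype.ofFinite Q
  infer_instance

theorem span_translates_inducedGenerator [Finite Q] {G : Type} [Group G] {π : G →* Q}
    (hπ : Function.Surjective π) (χ : K →* ℂˣ) :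
    Submodule.span ℂ (Set.range fun g ↦ inducedRepresentation π χ g (inducedGenerator χ)) = ⊤ := by
  classical
  have := Fintype.ofFinite Q
  rw [eq_top_iff]
  rintro f -
  choose s hs using hπ
  have hcount : ∀ x : Q, ∑ q : Q, (if q⁻¹ * x ∈ K then (1 : ℂ) else 0) =
      ∑ u : Q, if u ∈ K then (1 : ℂ) else 0 := fun x ↦
    Fintype.sum_equiv ((Equiv.inv Q).trans (Equiv.mulRight x)) _ _ fun _ ↦ rfl
  set M : ℂ := ∑ u : Q, if u ∈ K then (1 : ℂ) else 0 with hM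
  have hM0 : M ≠ 0 := by
    rw [hM, Finset.sum_boole]
    exact_mod_cast (Finset.card_pos.mpr ⟨1, by simp [K.one_mem]⟩).ne'
  have key : f = M⁻¹ • ∑ q : Q,
      f.1 q • inducedRepresentation π χ (s q) (inducedGenerator χ) := by
    rw [eq_inv_smul_iff₀ hM0]
    ext x
    simp only [Submodule.coe_smul, Submodule.coe_sum, Finset.sum_apply, Pi.smul_apply,
      smul_eq_mul, inducedRepresentation_apply, hs, ← hcount x, Finset.sum_mul]
    refine Finset.sum_congr rfl fun q _ ↦ ?_
    by_cases h : q⁻¹ * x ∈ K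
    · have := f.2 q ⟨_, h⟩
      rw [inducedGenerator_apply_of_mem χ h, if_pos h, one_mul]
      simpa [mul_comm] using this
    · rw [inducedGenerator_apply_of_notMem χ h, if_neg h, zero_mul, mul_zero]
  rw [key]
  exact Submodule.smul_mem _ _ (Submodule.sum_mem _ fun q _ ↦
    Submodule.smul_mem _ _ (Submodule.subset_span ⟨s q, rfl⟩))

/-- A linear character of a normal subgroup with trivial stabiliser induces an irreducible
character. -/
theorem index_mem_charDegrees [Finite Q] {G : Type} [Group G] [Finite G] [K.Normal] {π : G →* Q}
    (hπ : Function.Surjective π) (χ : K →* ℂˣ)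
    (hχ : ∀ g ∉ K, ∃ k : K, χ (MulAut.conjNormal g k) ≠ χ k) :
    K.index ∈ charDegrees G := by
  have := Fintype.ofFinite (Q ⧸ K)
  refine ⟨FDRep.of (inducedRepresentation π χ), ?_, ?_⟩
  · rw [FDRep.simple_iff_end_is_rank_one]
    have hne : inducedGenerator χ ≠ 0 := fun h ↦ by
      have h1 := inducedGenerator_apply_of_mem χ K.one_mem
      rw [h] at h1
      exact (χ ⟨1, K.one_mem⟩).ne_zero h1.symm
    refine finrank_eq_one_iff'.mpr ⟨𝟙 (FDRep.of (inducedRepresentation π χ)), ?_, ?_⟩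
    · intro h
      apply hne
      have := congrArg (fun T : FDRep.of (inducedRepresentation π χ) ⟶ _ ↦
        T.hom.hom.hom (inducedGenerator χ)) h
      exact this
    · intro T
      let t : inducedSpace χ →ₗ[ℂ] inducedSpace χ := T.hom.hom.hom
      have ht : ∀ g f, t (inducedRepresentation π χ g f) = inducedRepresentation π χ g (t f) :=
        fun g f ↦ congrArg (fun φ ↦ φ.hom.hom f) (T.comm g)
      set v := inducedGenerator χ with hv
      have hweight : ∀ x k : Q, ∀ hk : k ∈ K, (t v).1 (k * x) = χ ⟨k, hk⟩ * (t v).1 x := by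
        intro x k hk
        obtain ⟨g, hg⟩ := hπ k⁻¹
        have h1 : inducedRepresentation π χ g v = (χ ⟨k, hk⟩ : ℂ) • v := by
          ext y
          rw [inducedRepresentation_apply, hg, inv_inv, Submodule.coe_smul, Pi.smul_apply,
            smul_eq_mul]
          by_cases hy : y ∈ K
          · rw [hv, inducedGenerator_apply_of_mem χ hy,
              inducedGenerator_apply_of_mem χ (K.mul_mem hk hy), ← Units.val_mul, ← map_mul]
            rfl
          · rw [hv, inducedGenerator_apply_of_notMem χ hy, inducedGenerator_apply_of_notMem χ
              (by rwa [K.mul_mem_cancel_left hk]), mul_zero]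
        have h2 := ht g v
        rw [h1, map_smul] at h2
        have h3 := congrArg (fun f : inducedSpace χ ↦ f.1 x) h2
        simpa [inducedRepresentation_apply, hg] using h3.symm
      have hscalar : t v = (t v).1 1 • v := by
        ext x
        rw [Submodule.coe_smul, Pi.smul_apply, smul_eq_mul]
        by_cases hx : x ∈ K
        · rw [hv, inducedGenerator_apply_of_mem χ hx, mul_comm, ← hv, ← hweight, mul_one]
        · rw [hv, inducedGenerator_apply_of_notMem χ hx, mul_zero, ← hv]
          obtain ⟨k, hk⟩ := hχ x hx
          by_contra h0
          apply hk
          have h1 := hweight x (MulAut.conjNormal x k : K) (MulAut.conjNormal x k).2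
          have hx' : (MulAut.conjNormal x k : K) * x = x * k := by
            rw [MulAut.conjNormal_apply, inv_mul_cancel_right]
          rw [hx', (t v).2 x k] at h1
          have h2 := mul_right_cancel₀ h0 h1
          exact Units.ext h2.symm
      refine ⟨(t v).1 1, ?_⟩
      have hall : (t v).1 1 • LinearMap.id = t := by
        refine LinearMap.ext_on_range (span_translates_inducedGenerator hπ χ) fun g ↦ ?_
        rw [ht, ← hv]
        nth_rewrite 2 [hscalar]
        rw [map_smul]
        rfl
      ext f : 4
      exact congrArg Subtype.val (LinearMap.congr_fun hall f)
  · exact (inducedSpaceEquiv χ).finrank_eq.trans (by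
      rw [Module.finrank_fintype_fun_eq_card, Subgroup.index, Nat.card_eq_fintype_card])

end InducedRepresentation

section IrreducibleAction

open Polynomial
open scoped IsMulCommutative

/-- A finite domain all of whose elements satisfy `x ^ m = x`, `1 < m`, has at most `m`
elements. -/
theorem card_le_of_forall_pow_eq_self {E : Type*} [CommRing E] [IsDomain E] [Finite E] {m : ℕ}
    (hm : 1 < m) (h : ∀ e : E, e ^ m = e) : Nat.card E ≤ m := by
  have := Fintype.ofFinite E
  have hdeg : (X ^ m - X : E[X]).natDegree = m := by
    rw [natDegree_sub_eq_left_of_natDegree_lt] <;> simp [hm]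
  have hp0 : (X ^ m - X : E[X]) ≠ 0 := fun h0 ↦ by
    rw [h0, natDegree_zero] at hdeg
    omega
  rw [Nat.card_eq_fintype_card, ← hdeg]
  refine card_le_degree_of_subset_roots (Z := Finset.univ) fun e _ ↦ ?_
  rw [mem_roots hp0]
  simp [h]

/-- Let a group act irreducibly on an elementary abelian `r`-group of order `r ^ a`, with
commuting operators.  The image of the action has order dividing `r ^ a - 1`, and not dividing
`r ^ b - 1` for any `0 < b < a`. -/
theorem index_ker_dvd_and_minimal {Q A : Type} [Group Q] [AddCommGroup A] [Finite A]
    [Nontrivial A] (ρ : Q →* AddMonoid.End A) (hcomm : ∀ g h, ρ g * ρ h = ρ h * ρ g)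
    (hirr : ∀ B : AddSubgroup A, (∀ g, ∀ x ∈ B, ρ g x ∈ B) → B = ⊥ ∨ B = ⊤)
    {r a : ℕ} (hr : r.Prime) (htors : ∀ x : A, r • x = 0) (hcard : Nat.card A = r ^ a) :
    ρ.ker.index ∣ r ^ a - 1 ∧ ∀ b : ℕ, 0 < b → ρ.ker.index ∣ r ^ b - 1 → a ≤ b := by
  have : Fact r.Prime := ⟨hr⟩
  let E : Subring (AddMonoid.End A) := Subring.closure (Set.range ρ)
  have : IsMulCommutative E := Subring.isMulCommutative_closure (by
    rintro _ ⟨g, rfl⟩ _ ⟨h, rfl⟩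
    exact hcomm g h)
  have hρE : ∀ g, ρ g ∈ E := fun g ↦ Subring.subset_closure ⟨g, rfl⟩
  have hEcomm : ∀ (d e : E) (x : A), d.1 (e.1 x) = e.1 (d.1 x) := fun d e x ↦
    congrArg (fun f : E ↦ f.1 x) (mul_comm d e)
  have : Finite (AddMonoid.End A) := Finite.of_injective (fun f : AddMonoid.End A ↦ (f : A → A))
    DFunLike.coe_injective
  obtain ⟨x₀, hx₀⟩ := exists_ne (0 : A)
  have hker : ∀ e : E, e ≠ 0 → ∀ x, e.1 x = 0 → x = 0 := by
    intro e he x hx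
    rcases hirr (AddMonoidHom.ker (e.1 : A →+ A)) (fun g y hy ↦ by
      have hy' : e.1 y = 0 := hy
      have := hEcomm e ⟨ρ g, hρE g⟩ y
      rw [hy', map_zero] at this
      exact this) with h | h
    · have : x ∈ AddMonoidHom.ker (e.1 : A →+ A) := hx
      simpa [h] using this
    · refine absurd (Subtype.ext (DFunLike.ext _ _ fun y ↦ ?_)) he
      have : y ∈ AddMonoidHom.ker (e.1 : A →+ A) := h ▸ AddSubgroup.mem_top y
      exact this
  let ev : E →+ A := (AddMonoidHom.eval x₀).comp E.subtype.toAddMonoidHom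
  have hev_inj : Function.Injective ev := (injective_iff_map_eq_zero ev).mpr fun e he ↦ by
    by_contra h
    exact hx₀ (hker e h x₀ he)
  have hev_surj : Function.Surjective ev := by
    rcases hirr ev.range (by
      rintro g _ ⟨e, rfl⟩
      exact ⟨⟨ρ g, hρE g⟩ * e, rfl⟩) with h | h
    · have : x₀ ∈ ev.range := ⟨1, rfl⟩
      rw [h] at this
      exact absurd this hx₀
    · exact AddMonoidHom.range_eq_top.mp h
  have hEcard : Nat.card E = r ^ a := by
    rw [← hcard]
    exact Nat.card_congr (Equiv.ofBijective ev ⟨hev_inj, hev_surj⟩)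
  have : Nontrivial E := ⟨⟨1, 0, fun h ↦ hx₀ (congrArg (fun f : E ↦ f.1 x₀) h)⟩⟩
  have : NoZeroDivisors E := ⟨fun {d e} h ↦ by
    by_contra! hde
    exact hx₀ (hker e hde.2 x₀ (hker d hde.1 _ (congrArg (fun f : E ↦ f.1 x₀) h)))⟩
  have : IsDomain E := NoZeroDivisors.to_isDomain E
  have : CharP E r := by
    refine (CharP.charP_iff_prime_eq_zero hr).mpr (Subtype.ext (DFunLike.ext _ _ fun y ↦ ?_))
    have h : (((r : E) : AddMonoid.End A)) = (r : AddMonoid.End A) := rfl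
    rw [h, AddMonoid.End.natCast_apply, htors]
    rfl
  constructor
  · let : Field E := (Finite.isField_of_domain E).toField
    let ρE : Q →* E := ρ.codRestrict E hρE
    have hk : ρE.toHomUnits.ker = ρ.ker := by
      ext g
      simp only [MonoidHom.mem_ker, ← Units.val_inj, MonoidHom.coe_toHomUnits, Units.val_one]
      exact Subtype.ext_iff
    rw [← hk, Subgroup.index_ker, ← hEcard, ← Nat.card_units]
    exact Subgroup.card_subgroup_dvd_card _
  · intro b hb hdvd
    have hpow : ∀ g, ρ g ^ r ^ b = ρ g := by
      intro g
      obtain ⟨c, hc⟩ := hdvd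
      have h1 : r ^ b = ρ.ker.index * c + 1 := by
        have := Nat.pow_pos (n := b) hr.pos
        omega
      have h2 : ρ g ^ ρ.ker.index = 1 := by
        rw [← map_pow]
        exact Subgroup.pow_index_mem ρ.ker g
      rw [h1, pow_succ, pow_mul, h2, one_pow, one_mul]
    have hfix : ∀ e : E, e ^ r ^ b = e := by
      rintro ⟨e, he⟩
      induction he using Subring.closure_induction with
      | mem x hx =>
        obtain ⟨g, rfl⟩ := hx
        exact Subtype.ext (hpow g)
      | zero => exact zero_pow (pow_pos hr.pos b).ne'
      | one => exact one_pow _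
      | add x y hx hy ihx ihy =>
        have := add_pow_char_pow (p := r) (n := b) (⟨x, hx⟩ : E) ⟨y, hy⟩
        rw [ihx, ihy] at this
        exact this
      | neg x hx ihx =>
        have h : (-1 : E) ^ r ^ b = -1 := by
          have := add_pow_char_pow (p := r) (n := b) (1 : E) (-1)
          rw [add_neg_cancel, one_pow, zero_pow (pow_pos hr.pos b).ne'] at this
          exact (neg_eq_of_add_eq_zero_right this.symm).symm
        have := neg_pow (⟨x, hx⟩ : E) (r ^ b)
        rw [ihx, h, neg_one_mul] at this
        exact this
      | mul x y hx hy ihx ihy =>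
        have := mul_pow (⟨x, hx⟩ : E) ⟨y, hy⟩ (r ^ b)
        rw [ihx, ihy] at this
        exact this
    have hb1 : 1 < r ^ b := Nat.one_lt_pow hb.ne' hr.one_lt
    have hle := card_le_of_forall_pow_eq_self hb1 hfix
    rw [hEcard] at hle
    exact (Nat.pow_le_pow_iff_right hr.one_lt).mp hle

end IrreducibleAction

section CommutatorMinimal

open scoped IsMulCommutative commutatorElement

variable {Q : Type} [Group Q]

theorem isMulCommutative_commutator [Group.IsSolvable Q]
    (hmin : ∀ H : Subgroup Q, H.Normal → H ≠ ⊥ → commutator Q ≤ H) :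
    IsMulCommutative (commutator Q) := by
  by_cases hK : commutator Q = ⊥
  · rw [hK]
    infer_instance
  · rw [← Subgroup.le_centralizer_iff_isMulCommutative,
      ← Subgroup.commutator_eq_bot_iff_le_centralizer]
    by_contra h
    exact (Group.IsSolvable.commutator_lt_of_ne_bot hK).not_ge (hmin _ inferInstance h)

theorem exists_prime_forall_commutator_pow_eq_one [Finite Q] [IsMulCommutative (commutator Q)]
    (hmin : ∀ H : Subgroup Q, H.Normal → H ≠ ⊥ → commutator Q ≤ H) (hK : commutator Q ≠ ⊥) :
    ∃ r : ℕ, r.Prime ∧ ∀ x ∈ commutator Q, x ^ r = 1 := by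
  obtain ⟨r, hr, hdvd⟩ := Nat.exists_prime_and_dvd
    (fun h ↦ hK (Subgroup.card_eq_one.mp h) : Nat.card (commutator Q) ≠ 1)
  have : Fact r.Prime := ⟨hr⟩
  obtain ⟨x, hx⟩ := exists_prime_orderOf_dvd_card' r hdvd
  let H : Subgroup Q :=
    { carrier := {y | y ∈ commutator Q ∧ y ^ r = 1}
      one_mem' := ⟨one_mem _, one_pow r⟩
      mul_mem' := fun {y z} hy hz ↦ ⟨mul_mem hy.1 hz.1, by
        have h : Commute y z := setLike_mul_comm hy.1 hz.1
        rw [h.mul_pow, hy.2, hz.2, one_mul]⟩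
      inv_mem' := fun {y} hy ↦ ⟨inv_mem hy.1, by rw [inv_pow, hy.2, inv_one]⟩ }
  have hH : H.Normal := ⟨fun y hy g ↦ ⟨Subgroup.Normal.conj_mem inferInstance y hy.1 g, by
    rw [conj_pow, hy.2, mul_one, mul_inv_cancel]⟩⟩
  have hxH : (x : Q) ∈ H := ⟨x.2, by
    rw [← Subgroup.coe_pow, ← hx, pow_orderOf_eq_one, Subgroup.coe_one]⟩
  refine ⟨r, hr, fun y hy ↦ (hmin H hH (fun h ↦ ?_) hy).2⟩
  rw [h, Subgroup.mem_bot, OneMemClass.coe_eq_one] at hxH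
  rw [hxH, orderOf_one] at hx
  exact hr.one_lt.ne hx

theorem isPGroup_of_center_ne_bot [Finite Q]
    (hmin : ∀ H : Subgroup Q, H.Normal → H ≠ ⊥ → commutator Q ≤ H) (hK : commutator Q ≠ ⊥)
    (hZ : Subgroup.center Q ≠ ⊥) {r : ℕ} (hr : r.Prime)
    (hKr : ∀ x ∈ commutator Q, x ^ r = 1) : IsPGroup r Q := by
  have hKZ : (Abelianization.of (G := Q)).ker ≤ Subgroup.center Q := by
    rw [Abelianization.ker_of]
    exact hmin _ inferInstance hZ
  have : Group.IsNilpotent Q := Subgroup.isNilpotent_of_ker_le_center _ hKZ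
  obtain ⟨⟨x, hx⟩, hx0⟩ := Subgroup.ne_bot_iff_exists_ne_one.mp hK
  have hx1 : x ≠ 1 := fun h ↦ hx0 (Subtype.ext h)
  refine IsPGroup.of_card (Nat.eq_prime_pow_of_unique_prime_dvd Nat.card_pos.ne' ?_)
  intro p hp hpQ
  have : Fact p.Prime := ⟨hp⟩
  have : Fact r.Prime := ⟨hr⟩
  let P : Sylow p Q := default
  have hxP : x ∈ (P : Subgroup Q) := hmin P inferInstance (P.ne_bot_of_dvd_card hpQ) hx
  obtain ⟨k, hk⟩ := P.isPGroup' ⟨x, hxP⟩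
  have hk' : x ^ p ^ k = 1 := congrArg Subtype.val hk
  have ho : orderOf x = r := orderOf_eq_prime (hKr x hx) hx1
  have hrp : r ∣ p ^ k := ho ▸ orderOf_dvd_of_pow_eq_one hk'
  exact ((Nat.prime_dvd_prime_iff_eq hr hp).mp (hr.dvd_of_dvd_pow hrp)).symm

theorem normal_inf_centralizer_singleton {A : Subgroup Q} [IsMulCommutative A]
    (hA : commutator Q ≤ A) (g : Q) : (A ⊓ Subgroup.centralizer {g}).Normal := by
  have : A.Normal := .of_commutator_le _ hA
  refine ⟨fun x hx h ↦ ⟨Subgroup.Normal.conj_mem this x hx.1 h, ?_⟩⟩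
  have hxg : x * g = g * x := (Subgroup.mem_centralizer_singleton_iff.mp hx.2)
  have hk : ⁅g⁻¹, h⁻¹⁆ ∈ A :=
    hA (Subgroup.commutator_mem_commutator (Subgroup.mem_top _) (Subgroup.mem_top _))
  have hxk : x * ⁅g⁻¹, h⁻¹⁆ = ⁅g⁻¹, h⁻¹⁆ * x := setLike_mul_comm hx.1 hk
  have hconj : h⁻¹ * g * h = g * ⁅g⁻¹, h⁻¹⁆ := by
    rw [commutatorElement_def]
    group
  refine Subgroup.mem_centralizer_singleton_iff.mpr ?_
  calc h * x * h⁻¹ * g = h * (x * (h⁻¹ * g * h)) * h⁻¹ := by group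
    _ = h * ((h⁻¹ * g * h) * x) * h⁻¹ := by
        rw [hconj, ← mul_assoc x, hxg, mul_assoc g, hxk, ← mul_assoc g]
    _ = g * (h * x * h⁻¹) := by group

theorem eq_of_commutatorElement_eq {A : Subgroup Q} {g : Q}
    (hA : A ⊓ Subgroup.centralizer {g} = ⊥) {c d : Q} (hc : c ∈ A) (hd : d ∈ A)
    (h : ⁅g, c⁆ = ⁅g, d⁆) : c = d := by
  have hmem : d⁻¹ * c ∈ A ⊓ Subgroup.centralizer {g} := by
    refine ⟨A.mul_mem (A.inv_mem hd) hc, Subgroup.mem_centralizer_singleton_iff.mpr ?_⟩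
    rw [commutatorElement_def, commutatorElement_def] at h
    have h1 : c * g⁻¹ * c⁻¹ = d * g⁻¹ * d⁻¹ := by
      simpa only [mul_assoc, mul_right_inj] using h
    have h2 : c * g * c⁻¹ = d * g * d⁻¹ := by
      simpa only [mul_inv_rev, inv_inv, mul_assoc] using congrArg (·⁻¹) h1
    calc d⁻¹ * c * g = d⁻¹ * (c * g * c⁻¹) * c := by group
      _ = g * (d⁻¹ * c) := by rw [h2]; group
  rw [hA, Subgroup.mem_bot, inv_mul_eq_one] at hmem
  exact hmem.symm

theorem centralizer_le_commutator_of_center_eq_bot [Finite Q] [IsMulCommutative (commutator Q)]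
    (hmin : ∀ H : Subgroup Q, H.Normal → H ≠ ⊥ → commutator Q ≤ H) (hK : commutator Q ≠ ⊥)
    (hZ : Subgroup.center Q = ⊥) {x : Q} (hx : x ∈ commutator Q) (hx1 : x ≠ 1) :
    Subgroup.centralizer {x} ≤ commutator Q := by
  have hcentral : ∀ {A : Subgroup Q} [IsMulCommutative A], commutator Q ≤ A → ∀ g : Q,
      A ⊓ Subgroup.centralizer {g} ≠ ⊥ → g ∈ Subgroup.centralizer (commutator Q : Set Q) := by
    intro A _ hA g hg
    have h := hmin _ (normal_inf_centralizer_singleton hA g) hg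
    exact fun y hy ↦ Subgroup.mem_centralizer_singleton_iff.mp (h hy).2
  set C := Subgroup.centralizer (commutator Q : Set Q) with hC
  have hKC : commutator Q ≤ C := Subgroup.le_centralizer_iff_isMulCommutative.mpr inferInstance
  have : IsMulCommutative C := by
    rw [← Subgroup.le_centralizer_iff_isMulCommutative,
      ← Subgroup.commutator_eq_bot_iff_le_centralizer, eq_bot_iff, ← hZ]
    exact commutator_centralizer_commutator_le_center Q
  obtain ⟨g, hg⟩ : ∃ g, g ∉ C := by
    by_contra! h
    refine hK (eq_bot_iff.mpr fun y hy ↦ ?_)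
    rw [← hZ, Subgroup.mem_center_iff]
    exact fun g ↦ (h g y hy).symm
  have hbot : C ⊓ Subgroup.centralizer {g} = ⊥ := by
    by_contra h
    exact hg (hcentral hKC g h)
  have hcard : Nat.card C ≤ Nat.card (commutator Q) := by
    refine Nat.card_le_card_of_injective (fun c : C ↦ (⟨⁅g, (c : Q)⁆,
      Subgroup.commutator_mem_commutator (Subgroup.mem_top _) (Subgroup.mem_top _)⟩ :
      commutator Q)) fun c d h ↦ Subtype.ext ?_
    exact eq_of_commutatorElement_eq hbot c.2 d.2 (congrArg Subtype.val h)
  rw [Subgroup.eq_of_le_of_card_ge hKC hcard]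
  refine fun y hy ↦ hcentral le_rfl y fun h ↦ hx1 ?_
  rw [← Subgroup.mem_bot, ← h]
  exact ⟨hx, Subgroup.mem_centralizer_singleton_iff.mpr
    (Subgroup.mem_centralizer_singleton_iff.mp hy).symm⟩

/-- The conjugation action of a group on an abelian normal subgroup, written additively. -/
def conjAddEnd (K : Subgroup Q) [K.Normal] : Q →* AddMonoid.End (Additive K) where
  toFun g := MonoidHom.toAdditive (MulAut.conjNormal g : K ≃* K).toMonoidHom
  map_one' := DFunLike.ext _ _ fun x ↦
    congrArg (fun f : MulAut K ↦ Additive.ofMul (f x.toMul)) (map_one MulAut.conjNormal)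
  map_mul' g h := DFunLike.ext _ _ fun x ↦
    congrArg (fun f : MulAut K ↦ Additive.ofMul (f x.toMul)) (map_mul MulAut.conjNormal g h)

theorem ker_conjAddEnd (K : Subgroup Q) [K.Normal] :
    (conjAddEnd K).ker = Subgroup.centralizer (K : Set Q) := by
  ext g
  rw [MonoidHom.mem_ker, Subgroup.mem_centralizer_iff]
  constructor
  · intro h y hy
    have h1 : g * y * g⁻¹ = y :=
      congrArg (fun f : AddMonoid.End (Additive K) ↦ ((f (.ofMul ⟨y, hy⟩)).toMul : Q)) h
    exact (mul_inv_eq_iff_eq_mul.mp h1).symm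
  · intro h
    refine DFunLike.ext _ _ fun y ↦ Additive.toMul.injective (Subtype.ext ?_)
    exact mul_inv_eq_iff_eq_mul.mpr (h _ y.toMul.2).symm

theorem index_commutator_dvd_and_minimal [Finite Q] [IsMulCommutative (commutator Q)]
    (hmin : ∀ H : Subgroup Q, H.Normal → H ≠ ⊥ → commutator Q ≤ H) (hK : commutator Q ≠ ⊥)
    (hC : Subgroup.centralizer (commutator Q : Set Q) = commutator Q) {r a : ℕ} (hr : r.Prime)
    (hKr : ∀ x ∈ commutator Q, x ^ r = 1) (hcard : Nat.card (commutator Q) = r ^ a) :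
    (commutator Q).index ∣ r ^ a - 1 ∧
      ∀ b : ℕ, 0 < b → (commutator Q).index ∣ r ^ b - 1 → a ≤ b := by
  have hker := ker_conjAddEnd (commutator Q)
  rw [hC] at hker
  have : Nontrivial (commutator Q) := (Subgroup.nontrivial_iff_ne_bot _).mpr hK
  rw [← hker]
  refine index_ker_dvd_and_minimal (conjAddEnd (commutator Q)) ?_ ?_ hr ?_ hcard
  · intro g h
    have hgh : ⁅g, h⁆ ∈ (conjAddEnd (commutator Q)).ker := by
      rw [hker]
      exact Subgroup.commutator_mem_commutator (Subgroup.mem_top _) (Subgroup.mem_top _)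
    rw [← map_mul, ← map_mul, show g * h = ⁅g, h⁆ * (h * g) by rw [commutatorElement_def]; group,
      map_mul, MonoidHom.mem_ker.mp hgh, one_mul]
  · intro B hB
    let H : Subgroup Q := B.toSubgroup'.map (commutator Q).subtype
    have hH : H.Normal := by
      refine ⟨?_⟩
      rintro _ ⟨y, hy, rfl⟩ g
      exact ⟨_, hB g (Additive.ofMul y) hy, rfl⟩
    by_cases hbot : H = ⊥
    · left
      rw [eq_bot_iff]
      intro y hy
      have : (y.toMul : Q) ∈ H := ⟨y.toMul, hy, rfl⟩
      rw [hbot, Subgroup.mem_bot, OneMemClass.coe_eq_one] at this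
      exact this
    · right
      rw [eq_top_iff]
      rintro y -
      obtain ⟨z, hz, hzy⟩ := hmin H hH hbot y.toMul.2
      have h : Additive.ofMul z = y := Additive.toMul.injective (Subtype.ext hzy)
      exact h ▸ hz
  · intro x
    exact Additive.toMul.injective (Subtype.ext (hKr _ x.toMul.2))

theorem index_commutator_mem_charDegrees [Finite Q] [IsMulCommutative (commutator Q)]
    (hK : commutator Q ≠ ⊥)
    (hF : ∀ x ∈ commutator Q, x ≠ 1 → Subgroup.centralizer {x} ≤ commutator Q)
    {G : Type} [Group G] [Finite G] {π : G →* Q} (hπ : Function.Surjective π) :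
    (commutator Q).index ∈ charDegrees G := by
  obtain ⟨y, hy⟩ := (Subgroup.ne_bot_iff_exists_ne_one).mp hK
  obtain ⟨χ, hχ⟩ := CommGroup.exists_apply_ne_one_of_hasEnoughRootsOfUnity (commutator Q) ℂ hy
  refine index_mem_charDegrees hπ χ fun g hg ↦ ?_
  by_contra! h
  have hbot : commutator Q ⊓ Subgroup.centralizer {g} = ⊥ := by
    refine eq_bot_iff.mpr fun x hx ↦ ?_
    by_contra hx1
    exact hg (hF x hx.1 hx1 (Subgroup.mem_centralizer_singleton_iff.mpr
      (Subgroup.mem_centralizer_singleton_iff.mp hx.2).symm))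
  have hinj : Function.Injective fun k : commutator Q ↦ MulAut.conjNormal g k * k⁻¹ :=
    fun c d hcd ↦ Subtype.ext
      (eq_of_commutatorElement_eq hbot c.2 d.2 (congrArg Subtype.val hcd))
  obtain ⟨k, hk⟩ := Finite.surjective_of_injective hinj y
  apply hχ
  rw [← hk, map_mul, h, map_inv, mul_inv_cancel]

theorem commutator_ne_bot_of_not_comm (h : ¬ ∀ a b : Q, a * b = b * a) : commutator Q ≠ ⊥ := by
  intro h'
  refine h fun x y ↦ commutatorElement_eq_one_iff_mul_comm.mp ?_
  rw [← Subgroup.mem_bot, ← h']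
  exact Subgroup.commutator_mem_commutator (Subgroup.mem_top _) (Subgroup.mem_top _)

/-- If `N` is maximal with solvable nonabelian quotient, every nontrivial normal subgroup of the
quotient contains its commutator subgroup. -/
theorem commutator_quotient_le_of_normal {G : Type} [Group G] {N : Subgroup G} [N.Normal]
    [Group.IsSolvable (G ⧸ N)]
    (hmax : ∀ (N' : Subgroup G) [N'.Normal], N < N' →
      (∀ a b : G ⧸ N', a * b = b * a) ∨ ¬ Group.IsSolvable (G ⧸ N'))
    (H : Subgroup (G ⧸ N)) (hH : H.Normal) (hne : H ≠ ⊥) : commutator (G ⧸ N) ≤ H := by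
  set N' := H.comap (QuotientGroup.mk' N) with hN'
  have hlt : N < N' := by
    refine lt_of_le_of_ne ?_ fun h ↦ hne ?_
    · simpa [hN'] using QuotientGroup.le_comap_mk' N H
    · rw [← Subgroup.map_comap_eq_self_of_surjective (QuotientGroup.mk'_surjective N) H, ← hN',
        ← h, QuotientGroup.map_mk'_self]
  have hsolv' : Group.IsSolvable (G ⧸ N') :=
    Group.isSolvable_of_surjective (f := QuotientGroup.map N N' (MonoidHom.id G) hlt.le)
      (QuotientGroup.map_surjective_of_surjective _ _ _
        (QuotientGroup.mk_surjective.comp Function.surjective_id) _)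
  have hcomm := (hmax N' hlt).resolve_right (not_not.mpr hsolv')
  rw [commutator_def, Subgroup.commutator_le]
  intro x _ y _
  obtain ⟨g, rfl⟩ := QuotientGroup.mk'_surjective N x
  obtain ⟨h, rfl⟩ := QuotientGroup.mk'_surjective N y
  rw [← map_commutatorElement, ← Subgroup.mem_comap, ← hN', ← QuotientGroup.eq_one_iff]
  change ⁅(g : G ⧸ N'), (h : G ⧸ N')⁆ = 1
  exact commutatorElement_eq_one_iff_mul_comm.mpr (hcomm _ _)

end CommutatorMinimal

/-- Let `G` be a finite group and `N ⊴ G` with `G/N` solvable and nonabelian, and `N` maximal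
with these properties.  Then either `G/N` is an `r`-group for some prime `r`, or `G/N` is a
Frobenius group whose Frobenius kernel `F/N` is elementary abelian of order `r^a` for a prime
`r`, where `a` is the smallest positive integer with `r^a ≡ 1 (mod |G : F|)`, and `|G : F|` is
a character degree of `G`. -/
theorem minimal_nonabelian_solvable_quotient
    {G : Type} [Group G] [Fintype G] (N : Subgroup G) [N.Normal]
    (hsolv : IsSolvable (G ⧸ N)) (hnonab : ¬ ∀ a b : G ⧸ N, a * b = b * a)
    (hmax : ∀ (N' : Subgroup G) [N'.Normal], N < N' →
      (∀ a b : G ⧸ N', a * b = b * a) ∨ ¬ IsSolvable (G ⧸ N')) :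
    (∃ r : ℕ, r.Prime ∧ IsPGroup r (G ⧸ N)) ∨
      (∃ (F : Subgroup G) (r a : ℕ), F.Normal ∧ N ≤ F ∧ r.Prime ∧ 0 < a ∧
        IsFrobeniusWithKernel (G ⧸ N) (F.map (QuotientGroup.mk' N)) ∧
        IsElementaryAbelian r ↥(F.map (QuotientGroup.mk' N)) ∧
        Nat.card (F.map (QuotientGroup.mk' N)) = r ^ a ∧
        F.index ∈ charDegrees G ∧
        r ^ a % F.index = 1 % F.index ∧
        (∀ b : ℕ, 0 < b → r ^ b % F.index = 1 % F.index → a ≤ b)) := by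
  set Q := G ⧸ N
  have hsolv' : Group.IsSolvable Q := hsolv
  have hmin := commutator_quotient_le_of_normal (N := N) hmax
  have hK : commutator Q ≠ ⊥ := commutator_ne_bot_of_not_comm hnonab
  have := isMulCommutative_commutator hmin
  obtain ⟨r, hr, hKr⟩ := exists_prime_forall_commutator_pow_eq_one hmin hK
  by_cases hZ : Subgroup.center Q = ⊥
  · right
    have hF := fun x (hx : x ∈ commutator Q) (hx1 : x ≠ 1) ↦
      centralizer_le_commutator_of_center_eq_bot hmin hK hZ hx hx1
    have : Fact r.Prime := ⟨hr⟩
    have hpg : IsPGroup r (commutator Q) := fun x ↦ ⟨1, by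
      rw [pow_one]
      exact Subtype.ext (hKr x x.2)⟩
    obtain ⟨a, ha⟩ := IsPGroup.iff_card.mp hpg
    have ha0 : 0 < a := by
      refine Nat.pos_of_ne_zero fun h ↦ hK (Subgroup.card_eq_one.mp ?_)
      rw [ha, h, pow_zero]
    have hC : Subgroup.centralizer (commutator Q : Set Q) = commutator Q := by
      refine le_antisymm ?_ (Subgroup.le_centralizer_iff_isMulCommutative.mpr inferInstance)
      obtain ⟨x, hx⟩ := (Subgroup.ne_bot_iff_exists_ne_one).mp hK
      exact (Subgroup.centralizer_le (Set.singleton_subset_iff.mpr x.2)).trans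
        (hF x x.2 fun h ↦ hx (Subtype.ext h))
    obtain ⟨hdvd, hleast⟩ := index_commutator_dvd_and_minimal hmin hK hC hr hKr ha
    have hmap : ((commutator Q).comap (QuotientGroup.mk' N)).map (QuotientGroup.mk' N) =
        commutator Q :=
      Subgroup.map_comap_eq_self_of_surjective (QuotientGroup.mk'_surjective N) _
    have hindex : ((commutator Q).comap (QuotientGroup.mk' N)).index = (commutator Q).index :=
      Subgroup.index_comap_of_surjective _ (QuotientGroup.mk'_surjective N)
    refine ⟨(commutator Q).comap (QuotientGroup.mk' N), r, a, inferInstance,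
      QuotientGroup.le_comap_mk' N _, hr, ha0, ?_⟩
    rw [hmap, hindex]
    refine ⟨⟨inferInstance, hK, ?_, hF⟩, ⟨fun x y ↦ Subtype.ext (setLike_mul_comm x.2 y.2), fun x ↦
      Subtype.ext (hKr x x.2)⟩, ha, index_commutator_mem_charDegrees hK hF
        (QuotientGroup.mk'_surjective N), ?_, ?_⟩
    · intro h
      refine hnonab fun x y ↦ setLike_mul_comm (s := commutator Q) ?_ ?_ <;>
        exact h ▸ Subgroup.mem_top _
    · exact ((Nat.modEq_iff_dvd' (Nat.pow_pos hr.pos)).mpr hdvd).symm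
    · intro b hb hmod
      exact hleast b hb ((Nat.modEq_iff_dvd' (Nat.pow_pos hr.pos)).mp (Eq.symm hmod))
  · exact Or.inl ⟨r, hr, isPGroup_of_center_ne_bot hmin hK hZ hr hKr⟩
end

section
/- Let G be a finite group, N a minimal normal subgroup of G isomorphic to S^k where S is a nonabelian simple group, and let φ ∈ Irr(S) be an irreducible character that extends to Aut(S). Then the character φ^k = φ × ⋯ × φ of N ≅ S^k extends to an irreducible character of G. -/
open CategoryTheory Module

/-- `χ` is an irreducible complex character of `G`. -/
def IsIrrChar (G : Type) [Group G] (χ : G → ℂ) : Prop :=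
  ∃ V : FDRep ℂ G, Simple V ∧ V.character = χ

section CoordinatePermutation

variable {ι S : Type*}

/-- The automorphism `θ` of `ι → S` permutes the factors by `π`, mapping the `i`-th factor to the
`π i`-th one by `α i`. -/
def IsMonomialAut [Group S] (θ : MulAut (ι → S)) (π : Equiv.Perm ι) (α : ι → MulAut S) : Prop :=
  ∀ x i, θ x (π i) = α i (x i)

namespace IsMonomialAut

variable [Group S]

theorem one : IsMonomialAut (1 : MulAut (ι → S)) 1 1 := fun _ _ => rfl

theorem conj (x : ι → S) : IsMonomialAut (MulAut.conj x) 1 (fun i => MulAut.conj (x i)) :=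
  fun _ _ => by simp

theorem mul {θ θ' : MulAut (ι → S)} {π π' : Equiv.Perm ι} {α α' : ι → MulAut S}
    (h : IsMonomialAut θ π α) (h' : IsMonomialAut θ' π' α') :
    IsMonomialAut (θ * θ') (π * π') (fun i => α (π' i) * α' i) := fun x i => by
  simp only [MulAut.mul_apply, Equiv.Perm.mul_apply]
  rw [h, h']

theorem unique [Nontrivial S] {θ : MulAut (ι → S)} {π π' : Equiv.Perm ι} {α α' : ι → MulAut S}
    (h : IsMonomialAut θ π α) (h' : IsMonomialAut θ π' α') : π = π' ∧ α = α' := by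
  classical
  have hπ : π = π' := by
    ext i
    by_contra hne
    obtain ⟨s, hs⟩ := exists_ne (1 : S)
    have h1 := h' (Pi.mulSingle i s) i
    have h2 := h (Pi.mulSingle i s) (π.symm (π' i))
    have hi : π.symm (π' i) ≠ i := fun hi => hne (by rw [Equiv.symm_apply_eq] at hi; exact hi.symm)
    rw [Equiv.apply_symm_apply, h1, Pi.mulSingle_eq_same, Pi.mulSingle_eq_of_ne hi, map_one] at h2
    exact hs ((map_eq_one_iff _ (α' i).injective).1 h2)
  refine ⟨hπ, ?_⟩
  ext i s
  have h1 := h (Pi.mulSingle i s) i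
  rw [hπ, h', Pi.mulSingle_eq_same] at h1
  exact h1.symm

end IsMonomialAut

/-- Every homomorphism from a power of a simple group onto a finite nonabelian simple group factors
through a coordinate. -/
theorem exists_mulAut_of_surjective [Finite ι] [Group S] [Finite S] [IsSimpleGroup S]
    (hS : ∃ a b : S, a * b ≠ b * a) (p : (ι → S) →* S) (hp : Function.Surjective p) :
    ∃ (i : ι) (α : MulAut S), ∀ x, p x = α (x i) := by
  classical
  let f (i : ι) : S →* S := p.comp (MonoidHom.mulSingle (fun _ => S) i)
  have hf (i : ι) (s : S) : f i s = p (Pi.mulSingle i s) := rfl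
  have hrange (i : ι) : (f i).range = ⊥ ∨ (f i).range = ⊤ := by
    refine Subgroup.Normal.eq_bot_or_eq_top ⟨?_⟩
    rintro _ ⟨s, rfl⟩ g
    obtain ⟨x, rfl⟩ := hp g
    refine ⟨x i * s * (x i)⁻¹, ?_⟩
    rw [hf, hf, ← map_mul, ← map_inv, ← map_mul]
    congr 1
    ext j
    rcases eq_or_ne j i with rfl | hj
    · simp
    · simp [Pi.mulSingle_eq_of_ne hj]
  obtain ⟨i, hi⟩ : ∃ i, (f i).range = ⊤ := by
    by_contra! hbot
    have hp1 : p = 1 := MonoidHom.pi_ext fun i x => by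
      have := (MonoidHom.range_eq_bot_iff.1 ((hrange i).resolve_right (hbot i)))
      rw [← hf, this]
      rfl
    obtain ⟨s, hs⟩ := exists_ne (1 : S)
    obtain ⟨x, rfl⟩ := hp s
    exact hs (by rw [hp1]; rfl)
  have hother (j : ι) (hj : j ≠ i) : f j = 1 := by
    refine MonoidHom.range_eq_bot_iff.1 ((hrange j).resolve_right fun hj' => ?_)
    obtain ⟨a, b, hab⟩ := hS
    obtain ⟨a, rfl⟩ := MonoidHom.range_eq_top.1 hi a
    obtain ⟨b, rfl⟩ := MonoidHom.range_eq_top.1 hj' b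
    refine hab ?_
    rw [hf, hf, ← map_mul, ← map_mul,
      (Pi.mulSingle_commute (f := fun _ => S) hj.symm a b).eq]
  have hbij : Function.Bijective (f i) :=
    Function.Surjective.bijective_of_finite (MonoidHom.range_eq_top.1 hi)
  refine ⟨i, MulEquiv.ofBijective (f i) hbij, fun x => ?_⟩
  suffices p = (f i).comp (Pi.evalMonoidHom (fun _ => S) i) from DFunLike.congr_fun this x
  refine MonoidHom.pi_ext fun j s => ?_
  rcases eq_or_ne j i with rfl | hj
  · simp [hf]
  · rw [← hf, hother j hj]
    simp [Pi.mulSingle_eq_of_ne hj.symm]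

/-- Automorphisms of a power of a finite nonabelian simple group permute its factors. -/
theorem exists_isMonomialAut [Finite ι] [Group S] [Finite S] [IsSimpleGroup S]
    (hS : ∃ a b : S, a * b ≠ b * a) (θ : MulAut (ι → S)) :
    ∃ π α, IsMonomialAut θ π α := by
  classical
  have hcoord (j : ι) : ∃ (i : ι) (α : MulAut S), ∀ x, θ x j = α (x i) :=
    exists_mulAut_of_surjective hS ((Pi.evalMonoidHom (fun _ => S) j).comp θ.toMonoidHom)
      ((Function.surjective_eval j).comp θ.surjective)
  choose σ α hα using hcoord
  have hσ : Function.Surjective σ := fun i => by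
    by_contra! hi
    obtain ⟨s, hs⟩ := exists_ne (1 : S)
    have h1 : θ (Pi.mulSingle i s) = 1 := by
      ext j
      rw [hα, Pi.mulSingle_eq_of_ne (hi j), map_one, Pi.one_apply]
    exact hs (Pi.mulSingle_eq_one_iff.1 ((map_eq_one_iff _ θ.injective).1 h1))
  let τ : Equiv.Perm ι := Equiv.ofBijective σ (Finite.surjective_iff_bijective.1 hσ)
  refine ⟨τ⁻¹, fun i => α (τ⁻¹ i), fun x i => ?_⟩
  rw [hα]
  congr 2
  exact τ.apply_symm_apply i

end CoordinatePermutation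

section WreathMatrix

variable {ι d R A : Type*} [Fintype ι] [Fintype d] [DecidableEq d] [CommRing R] [Group A]

/-- The action on the tensor power of a matrix representation `ρ` of the element of the wreath
product `A ≀ Perm ι` with components `α` and permutation `π`. -/
def wreathMatrix (ρ : A →* Matrix d d R) (π : Equiv.Perm ι) (α : ι → A) :
    Matrix (ι → d) (ι → d) R :=
  Matrix.of fun a b => ∏ i, ρ (α i) (a (π i)) (b i)

theorem wreathMatrix_one (ρ : A →* Matrix d d R) :
    wreathMatrix ρ (1 : Equiv.Perm ι) 1 = 1 := by
  ext a b
  simp [wreathMatrix, Matrix.one_apply, Fintype.prod_ite_zero, funext_iff]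

theorem wreathMatrix_mul [DecidableEq ι] (ρ : A →* Matrix d d R) (π π' : Equiv.Perm ι)
    (α α' : ι → A) :
    wreathMatrix ρ π α * wreathMatrix ρ π' α' =
      wreathMatrix ρ (π * π') (fun i => α (π' i) * α' i) := by
  ext a c
  simp only [wreathMatrix, Matrix.mul_apply, Matrix.of_apply, map_mul, Equiv.Perm.mul_apply]
  rw [Finset.prod_univ_sum, Fintype.piFinset_univ]
  refine Fintype.sum_equiv (Equiv.arrowCongr π'.symm (Equiv.refl d)) _ _ fun b => ?_
  rw [Finset.prod_mul_distrib, ← Equiv.prod_comp π' fun i => ρ (α i) (a (π i)) (b i)]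
  simp

theorem trace_wreathMatrix_one [DecidableEq ι] (ρ : A →* Matrix d d R) (α : ι → A) :
    (wreathMatrix ρ 1 α).trace = ∏ i, (ρ (α i)).trace := by
  simp only [wreathMatrix, Matrix.trace, Matrix.diag_apply, Matrix.of_apply,
    Equiv.Perm.one_apply]
  rw [Finset.prod_univ_sum, Fintype.piFinset_univ]

end WreathMatrix

section Characters

/-- A representation of a finite group whose restriction along a homomorphism is irreducible is
itself irreducible. -/
theorem FDRep.simple_of_simple_res {k : Type} [Field k] [IsAlgClosed k] [CharZero k]
    {G H : Type} [Group G] [Finite G] [Group H] [Finite H] (f : H →* G) (V : FDRep k G)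
    (hV : Simple ((Action.res (FGModuleCat k) f).obj V)) : Simple V := by
  rw [FDRep.simple_iff_end_is_rank_one] at hV ⊢
  refine le_antisymm ?_ ?_
  · rw [← hV]
    exact LinearMap.finrank_le_finrank_of_injective
      (f := (Action.res (FGModuleCat k) f).mapLinearMap k)
      (Action.res (FGModuleCat k) f).map_injective
  · refine Module.finrank_pos_iff_exists_ne_zero.2 ⟨𝟙 V, fun h => ?_⟩
    have h0 : 𝟙 ((Action.res (FGModuleCat k) f).obj V) = 0 := by
      rw [← (Action.res (FGModuleCat k) f).map_id V, h, Functor.map_zero]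
    obtain ⟨g, hg⟩ := Module.finrank_pos_iff_exists_ne_zero.1 (hV.symm ▸ Nat.one_pos)
    exact hg (by rw [← Category.id_comp g, h0, Limits.zero_comp])

/-- A matrix representation affording the character of a given representation. -/
theorem FDRep.exists_matrix_hom {k G : Type} [Field k] [Monoid G] (V : FDRep k G) :
    ∃ (d : ℕ) (ρ : G →* Matrix (Fin d) (Fin d) k), ∀ g, (ρ g).trace = V.character g := by
  let b := Module.finBasis k V
  refine ⟨_, (MonoidHomClass.toMonoidHom (LinearMap.toMatrixAlgEquiv b)).comp V.ρ, fun g => ?_⟩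
  exact (LinearMap.trace_eq_matrix_trace k b (V.ρ g)).symm

/-- The character of an external tensor power of an irreducible representation has norm `1`. -/
theorem sum_prod_char_mul_inv {ι S : Type} [Fintype ι] [DecidableEq ι] [Group S] [Fintype S]
    {φ : S → ℂ} (hφ : IsIrrChar S φ) :
    ∑ x : ι → S, (∏ i, φ (x i)) * ∏ i, φ (x i)⁻¹ = Nat.card (ι → S) := by
  obtain ⟨V, hV, rfl⟩ := hφ
  rw [FDRep.simple_iff_char_is_norm_one] at hV
  simp_rw [← Finset.prod_mul_distrib]
  rw [← Fintype.piFinset_univ,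
    ← Finset.prod_univ_sum (fun _ => Finset.univ) fun _ s => V.character s * V.character s⁻¹]
  simp [hV]

end Characters

/-- Let `G` be a finite group and `N` a minimal normal subgroup of `G` isomorphic to `S^k`,
where `S` is a nonabelian simple group, and let `φ ∈ Irr(S)` extend to `Aut(S)`.  Then the
character `φ^k = φ × ⋯ × φ` of `N ≅ S^k` extends to an irreducible character of `G`. -/
theorem tensor_power_character_extends
    {G S : Type} [Group G] [Fintype G] [Group S] [Fintype S]
    (hS : IsSimpleGroup S) (hSna : ∃ a b : S, a * b ≠ b * a)
    (N : Subgroup G) [N.Normal] (hbot : N ≠ ⊥)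
    (hmin : ∀ (N' : Subgroup G) [N'.Normal], N' < N → N' = ⊥)
    (k : ℕ) (e : N ≃* (Fin k → S))
    (φ : S → ℂ) (hφ : IsIrrChar S φ)
    (hext : ∃ Φ : MulAut S → ℂ, IsIrrChar (MulAut S) Φ ∧
      ∀ s : S, Φ (MulAut.conj s) = φ s) :
    ∃ χ : G → ℂ, IsIrrChar G χ ∧ ∀ n : N, χ (n : G) = ∏ i, φ (e n i) := by
  classical
  obtain ⟨Φ, ⟨V, -, rfl⟩, hΦ⟩ := hext
  obtain ⟨d, ρ, hρ⟩ := V.exists_matrix_hom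
  let θ : G →* MulAut (Fin k → S) := (MulAut.congr e).toMonoidHom.comp MulAut.conjNormal
  have hθ (n : N) : θ n = MulAut.conj (e n) := by
    ext x i
    simp [θ, MulAut.congr, MulAut.conjNormal_val]
  choose π α hπα using fun g => exists_isMonomialAut hSna (θ g)
  have heq {g : G} {π' α'} (h : IsMonomialAut (θ g) π' α') :
      wreathMatrix ρ (π g) (α g) = wreathMatrix ρ π' α' := by
    obtain ⟨h1, h2⟩ := (hπα g).unique h
    rw [h1, h2]
  let M : G →* Matrix (Fin k → Fin d) (Fin k → Fin d) ℂ :=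
    { toFun g := wreathMatrix ρ (π g) (α g)
      map_one' := by
        rw [heq (by rw [map_one]; exact .one), wreathMatrix_one]
      map_mul' g h := by
        rw [heq (by rw [map_mul]; exact (hπα g).mul (hπα h)), wreathMatrix_mul] }
  let W : FDRep ℂ G := FDRep.of ((MonoidHomClass.toMonoidHom Matrix.toLinAlgEquiv').comp M)
  have hW (n : N) : W.character n = ∏ i, φ (e n i) := by
    have h1 : W.character n = (wreathMatrix ρ (π n) (α n)).trace := Matrix.trace_toLin'_eq _
    rw [h1, heq (by rw [hθ]; exact .conj _), trace_wreathMatrix_one]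
    simp only [hρ, hΦ]
  refine ⟨W.character, ⟨W, FDRep.simple_of_simple_res N.subtype W ?_, rfl⟩, hW⟩
  rw [FDRep.simple_iff_char_is_norm_one]
  have hres (n : N) : FDRep.character ((Action.res (FGModuleCat ℂ) N.subtype).obj W) n =
      ∏ i, φ (e n i) := hW n
  simp only [hres, map_inv, Pi.inv_apply]
  rw [Nat.card_congr e.toEquiv, ← sum_prod_char_mul_inv hφ]
  exact Equiv.sum_comp e.toEquiv fun x => (∏ i, φ (x i)) * ∏ i, φ (x i)⁻¹
end
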